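/- Let q ∈ ℕ and let B₀ : [0,1] → ℝ^{1×q} be the row vector of monomials B₀(u) = (1, u, …, u^{q−1}). Let A₁, A₂ ∈ ℝ^{q×q} and define B₁ : [0,1] → ℝ^{1×q} by B₁(u) := B₀(u)·A₁·1{0 ≤ u < 1/2} + B₀(u)·A₂·1{1/2 ≤ u ≤ 1}, and assume ∫₀¹ B₁(u)ᵀ B₀(u) du = 0 (every component of B₁ is orthogonal in L²([0,1]) to every component of B₀). For k ∈ ℕ and l ∈ {1,…,2^{k−1}} define B_{k,l}(u) := B₁(2^{k−1}·(u − (l−1)·2^{−(k−1)}))·1{(l−1)·2^{−(k−1)} ≤ u < l·2^{−(k−1)}}. Then: (i) ∫₀¹ B₀(u)ᵀ B_{k,l}(u) du = 0 for every k ∈ ℕ and l ∈ {1,…,2^{k−1}}; and (ii) ∫₀¹ B_{k₁,l₁}(u)ᵀ B_{k₂,l₂}(u) du = 0 whenever k₁ ≠ k₂, for all l₁ ∈ {1,…,2^{k₁−1}} and l₂ ∈ {1,…,2^{k₂−1}}. -/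

import Mathlib

open Set MeasureTheory

/-- The row vector of monomials `B₀(u) = (1, u, …, u^{q-1})`. -/
noncomputable def B0 (q : ℕ) : ℝ → Fin q → ℝ := fun u i => u ^ (i : ℕ)

/-- `B₁(u) := B₀(u)·A₁·1{0 ≤ u < 1/2} + B₀(u)·A₂·1{1/2 ≤ u ≤ 1}`. -/
noncomputable def B1 (q : ℕ) (A₁ A₂ : Matrix (Fin q) (Fin q) ℝ) : ℝ → Fin q → ℝ :=
  fun u i =>
    (Set.Ico (0:ℝ) (1/2)).indicator (fun t => ∑ j, B0 q t j * A₁ j i) u +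
    (Set.Icc (1/2:ℝ) 1).indicator (fun t => ∑ j, B0 q t j * A₂ j i) u

/-- `B_{k,l}(u) := B₁(2^{k-1}(u − (l−1)2^{-(k-1)}))·1{(l−1)2^{-(k-1)} ≤ u < l·2^{-(k-1)}}`. -/
noncomputable def Bkl (q : ℕ) (A₁ A₂ : Matrix (Fin q) (Fin q) ℝ) (k l : ℕ) : ℝ → Fin q → ℝ :=
  fun u i =>
    (Set.Ico (((l:ℝ) - 1) * (2:ℝ) ^ (-((k:ℝ) - 1))) ((l:ℝ) * (2:ℝ) ^ (-((k:ℝ) - 1)))).indicator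
      (fun t => B1 q A₁ A₂ ((2:ℝ) ^ ((k:ℝ) - 1) * (t - ((l:ℝ) - 1) * (2:ℝ) ^ (-((k:ℝ) - 1)))) i) u

open Polynomial in
/-- The polynomial whose coefficients are the entries of the `i`-th column of `A`. -/
noncomputable def colPoly {q : ℕ} (A : Matrix (Fin q) (Fin q) ℝ) (i : Fin q) : ℝ[X] :=
  ∑ j : Fin q, C (A j i) * X ^ (j : ℕ)

theorem eval_colPoly {q : ℕ} (A : Matrix (Fin q) (Fin q) ℝ) (i : Fin q) (t : ℝ) :
    (colPoly A i).eval t = ∑ j, B0 q t j * A j i := by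
  simp only [colPoly, B0, Polynomial.eval_finsetSum, Polynomial.eval_mul, Polynomial.eval_C,
    Polynomial.eval_pow, Polynomial.eval_X]
  exact Finset.sum_congr rfl fun j _ => mul_comm _ _

theorem natDegree_colPoly_lt {q : ℕ} (A : Matrix (Fin q) (Fin q) ℝ) (i : Fin q) :
    (colPoly A i).natDegree < q := by
  have hq : 0 < q := i.pos
  refine lt_of_le_of_lt (Polynomial.natDegree_sum_le_of_forall_le (n := q - 1) _ _ ?_) (by omega)
  intro j _
  exact (Polynomial.natDegree_C_mul_X_pow_le _ _).trans (by omega)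

/-- `B₁` restricted to `[0,1)` and extended by zero to the real line. -/
noncomputable def motherWavelet {q : ℕ} (A₁ A₂ : Matrix (Fin q) (Fin q) ℝ) (i : Fin q) : ℝ → ℝ :=
  (Ico (0:ℝ) 1).indicator fun u => B1 q A₁ A₂ u i

section

variable {q : ℕ} (A₁ A₂ : Matrix (Fin q) (Fin q) ℝ) (i : Fin q)

theorem motherWavelet_of_notMem {u : ℝ} (hu : u ∉ Ico (0:ℝ) 1) :
    motherWavelet A₁ A₂ i u = 0 :=
  indicator_of_notMem hu _

theorem motherWavelet_of_lt_half {u : ℝ} (h0 : 0 ≤ u) (h1 : u < 1 / 2) :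
    motherWavelet A₁ A₂ i u = (colPoly A₁ i).eval u := by
  rw [motherWavelet, indicator_of_mem (by constructor <;> linarith), B1,
    indicator_of_mem (mem_Ico.mpr ⟨h0, h1⟩), indicator_of_notMem (fun h => absurd h.1 (not_le.mpr h1)),
    eval_colPoly, add_zero]

theorem motherWavelet_of_half_le {u : ℝ} (h0 : 1 / 2 ≤ u) (h1 : u < 1) :
    motherWavelet A₁ A₂ i u = (colPoly A₂ i).eval u := by
  rw [motherWavelet, indicator_of_mem (by constructor <;> linarith), B1,
    indicator_of_notMem (fun h => absurd h.2 (not_lt.mpr h0)), indicator_of_mem (mem_Icc.mpr ⟨h0, h1.le⟩),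
    eval_colPoly, zero_add]

theorem motherWavelet_eq_add : motherWavelet A₁ A₂ i =
    (Ico (0:ℝ) (1 / 2)).indicator (fun u => (colPoly A₁ i).eval u) +
      (Ico (1 / 2 : ℝ) 1).indicator (fun u => (colPoly A₂ i).eval u) := by
  funext u
  rw [Pi.add_apply]
  by_cases h0 : 0 ≤ u
  · by_cases h1 : u < 1 / 2
    · rw [motherWavelet_of_lt_half _ _ _ h0 h1, indicator_of_mem (mem_Ico.mpr ⟨h0, h1⟩),
        indicator_of_notMem (fun h => absurd h.1 (not_le.mpr h1)), add_zero]
    · rw [indicator_of_notMem (fun h => h1 h.2), zero_add]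
      by_cases h2 : u < 1
      · rw [motherWavelet_of_half_le _ _ _ (not_lt.mp h1) h2,
          indicator_of_mem (mem_Ico.mpr ⟨not_lt.mp h1, h2⟩)]
      · rw [motherWavelet_of_notMem _ _ _ (fun h => h2 h.2),
          indicator_of_notMem (fun h => h2 h.2)]
  · rw [motherWavelet_of_notMem _ _ _ (fun h => h0 h.1), indicator_of_notMem (fun h => h0 h.1),
      indicator_of_notMem (fun h => h0 (by linarith [h.1])), add_zero]

theorem integrable_mul_motherWavelet {f : ℝ → ℝ} (hf : Continuous f) :
    Integrable fun u => f u * motherWavelet A₁ A₂ i u := by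
  have key : ∀ (a b : ℝ) (p : Polynomial ℝ),
      Integrable fun u => f u * (Ico a b).indicator (fun u => p.eval u) u := by
    intro a b p
    have hp : Integrable ((Ico a b).indicator fun u => f u * p.eval u) :=
      (integrable_indicator_iff measurableSet_Ico).mpr
        ((hf.mul p.continuous).integrableOn_Icc.mono_set Ico_subset_Icc_self)
    refine hp.congr (ae_of_all _ fun u => ?_)
    by_cases hu : u ∈ Ico a b <;> simp [hu]
  simp only [motherWavelet_eq_add, Pi.add_apply, mul_add]
  exact (key _ _ _).add (key _ _ _)

/-- Moments of `B₁` against polynomials of degree less than `q` vanish. -/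
theorem integral_polynomial_mul_motherWavelet
    (horth : ∀ i i' : Fin q, (∫ u in Set.Icc (0:ℝ) 1, B1 q A₁ A₂ u i * B0 q u i') = 0)
    {p : Polynomial ℝ} (hp : p.natDegree < q) :
    ∫ u, p.eval u * motherWavelet A₁ A₂ i u = 0 := by
  simp only [Polynomial.eval_eq_sum_range' hp, Finset.sum_mul]
  rw [integral_finsetSum _ fun j _ =>
    integrable_mul_motherWavelet A₁ A₂ i (by fun_prop : Continuous fun u : ℝ => p.coeff j * u ^ j)]
  refine Finset.sum_eq_zero fun j hj => ?_
  have h := horth i ⟨j, Finset.mem_range.mp hj⟩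
  rw [integral_Icc_eq_integral_Ico, ← integral_indicator measurableSet_Ico] at h
  simp only [mul_assoc]
  rw [integral_const_mul]
  refine mul_eq_zero_of_right _ (Eq.trans (integral_congr_ae (ae_of_all _ fun u => ?_)) h)
  by_cases hu : u ∈ Ico (0:ℝ) 1 <;> simp [motherWavelet, B0, hu, -mem_Ico, mul_comm]

theorem Bkl_succ_succ (n m : ℕ) (u : ℝ) :
    Bkl q A₁ A₂ (n + 1) (m + 1) u i = motherWavelet A₁ A₂ i (2 ^ n * u - m) := by
  have hpos : (0:ℝ) < 2 ^ n := by positivity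
  have hmem : u ∈ Ico ((m:ℝ) * ((2:ℝ) ^ n)⁻¹) (((m:ℝ) + 1) * ((2:ℝ) ^ n)⁻¹) ↔
      2 ^ n * u - m ∈ Ico (0:ℝ) 1 := by
    rw [← div_eq_mul_inv, ← div_eq_mul_inv, mem_Ico, mem_Ico, div_le_iff₀ hpos, lt_div_iff₀ hpos,
      mul_comm u, sub_nonneg, sub_lt_iff_lt_add']
  have harg : (2:ℝ) ^ n * (u - m * ((2:ℝ) ^ n)⁻¹) = 2 ^ n * u - m := by
    field_simp
  simp only [Bkl, Nat.cast_add, Nat.cast_one, add_sub_cancel_right, Real.rpow_neg zero_le_two,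
    Real.rpow_natCast, motherWavelet]
  by_cases hu : 2 ^ n * u - m ∈ Ico (0:ℝ) 1
  · rw [indicator_of_mem (hmem.mpr hu), indicator_of_mem hu, harg]
  · rw [indicator_of_notMem (fun h => hu (hmem.mp h)), indicator_of_notMem hu]

/-- A function agreeing on the support of `B_{n+1,m+1}` with a polynomial of degree less than `q`
in the rescaled variable is orthogonal to `B_{n+1,m+1}`. -/
theorem integral_mul_Bkl_eq_zero
    (horth : ∀ i i' : Fin q, (∫ u in Set.Icc (0:ℝ) 1, B1 q A₁ A₂ u i * B0 q u i') = 0)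
    {n m : ℕ} (hm : m < 2 ^ n) {f : ℝ → ℝ} {p : Polynomial ℝ} (hp : p.natDegree < q)
    (hf : ∀ v ∈ Ico (0:ℝ) 1, f ((v + m) / 2 ^ n) = p.eval v) :
    ∫ u in Icc (0:ℝ) 1, f u * Bkl q A₁ A₂ (n + 1) (m + 1) u i = 0 := by
  have hpos : (0:ℝ) < 2 ^ n := by positivity
  have hm' : (m:ℝ) + 1 ≤ 2 ^ n := by exact_mod_cast hm
  have heq : ∀ u, f u * Bkl q A₁ A₂ (n + 1) (m + 1) u i =
      (fun v => p.eval v * motherWavelet A₁ A₂ i v) (2 ^ n * u - m) := by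
    intro u
    rw [Bkl_succ_succ]
    by_cases hu : 2 ^ n * u - m ∈ Ico (0:ℝ) 1
    · have h := hf _ hu
      rw [sub_add_cancel, mul_div_cancel_left₀ _ hpos.ne'] at h
      rw [h]
    · simp only [motherWavelet_of_notMem _ _ _ hu, mul_zero]
  rw [setIntegral_eq_integral_of_forall_compl_eq_zero]
  · simp only [heq]
    rw [Measure.integral_comp_mul_left
      (fun x => (fun v => p.eval v * motherWavelet A₁ A₂ i v) (x - m)),
      integral_sub_right_eq_self (fun v => p.eval v * motherWavelet A₁ A₂ i v),
      integral_polynomial_mul_motherWavelet A₁ A₂ i horth hp, smul_zero]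
  · intro u hu
    rw [Bkl_succ_succ, motherWavelet_of_notMem, mul_zero]
    refine fun h => hu ⟨?_, ?_⟩
    · have : (0:ℝ) ≤ 2 ^ n * u := by linarith [h.1, (Nat.cast_nonneg m : (0:ℝ) ≤ m)]
      exact nonneg_of_mul_nonneg_right this hpos
    · refine le_of_mul_le_mul_left ?_ hpos
      linarith [h.2]

theorem natDegree_comp_linear_lt {p : Polynomial ℝ} (hp : p.natDegree < q) (a b : ℝ) :
    (p.comp (Polynomial.C a * Polynomial.X + Polynomial.C b)).natDegree < q := by
  refine lt_of_le_of_lt Polynomial.natDegree_comp_le (lt_of_le_of_lt ?_ hp)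
  exact (Nat.mul_le_mul_left _ Polynomial.natDegree_linear_le).trans (mul_one _).le

/-- On each dyadic interval of length at most `1/2`, the mother wavelet is a polynomial. -/
theorem exists_polynomial_eq_motherWavelet (d m₁ m₂ : ℕ) :
    ∃ p : Polynomial ℝ, p.natDegree < q ∧ ∀ v ∈ Ico (0:ℝ) 1,
      motherWavelet A₁ A₂ i ((v + m₂) / 2 ^ (d + 1) - m₁) = p.eval v := by
  have hpos : (0:ℝ) < 2 ^ (d + 1) := by positivity
  have hlin : ∀ P : Polynomial ℝ, P.natDegree < q →
      ∃ p : Polynomial ℝ, p.natDegree < q ∧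
        ∀ v : ℝ, P.eval ((v + m₂) / 2 ^ (d + 1) - m₁) = p.eval v := by
    intro P hP
    refine ⟨_, natDegree_comp_linear_lt hP (1 / 2 ^ (d + 1)) (m₂ / 2 ^ (d + 1) - m₁), fun v => ?_⟩
    simp only [Polynomial.eval_comp, Polynomial.eval_add, Polynomial.eval_mul, Polynomial.eval_C,
      Polynomial.eval_X]
    congr 1
    ring
  have hlt : ∀ (v c : ℝ), (v + m₂) / 2 ^ (d + 1) - m₁ < c ↔ v + m₂ < (c + m₁) * 2 ^ (d + 1) := by
    intro v c
    rw [sub_lt_iff_lt_add, div_lt_iff₀ hpos]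
  have hle : ∀ (v c : ℝ), c ≤ (v + m₂) / 2 ^ (d + 1) - m₁ ↔ (c + m₁) * 2 ^ (d + 1) ≤ v + m₂ := by
    intro v c
    rw [le_sub_iff_add_le, le_div_iff₀ hpos]
  have hcell : ∀ N : ℕ, (∀ v ∈ Ico (0:ℝ) 1, v + m₂ < N) ∨ (∀ v ∈ Ico (0:ℝ) 1, (N:ℝ) ≤ v + m₂) := by
    intro N
    rcases lt_or_ge m₂ N with h | h
    · refine Or.inl fun v hv => ?_
      have : (m₂:ℝ) + 1 ≤ N := by exact_mod_cast h
      linarith [hv.2]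
    · refine Or.inr fun v hv => ?_
      have : (N:ℝ) ≤ m₂ := by exact_mod_cast h
      linarith [hv.1]
  have hzero : (0 : Polynomial ℝ).natDegree < q := by simpa using i.pos
  rcases hcell (m₁ * 2 ^ (d + 1)) with h0 | h0
  · refine ⟨0, hzero, fun v hv => ?_⟩
    rw [motherWavelet_of_notMem, Polynomial.eval_zero]
    refine fun h => absurd h.1 (not_le.mpr ((hlt _ _).mpr ?_))
    simpa using h0 v hv
  rcases hcell ((2 * m₁ + 1) * 2 ^ d) with h1 | h1
  · obtain ⟨p, hp, hpe⟩ := hlin _ (natDegree_colPoly_lt A₁ i)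
    refine ⟨p, hp, fun v hv => ?_⟩
    rw [motherWavelet_of_lt_half, hpe]
    · rw [hle]
      simpa using h0 v hv
    · rw [hlt]
      have := h1 v hv
      push_cast at this
      rw [pow_succ]
      linarith
  rcases hcell ((m₁ + 1) * 2 ^ (d + 1)) with h2 | h2
  · obtain ⟨p, hp, hpe⟩ := hlin _ (natDegree_colPoly_lt A₂ i)
    refine ⟨p, hp, fun v hv => ?_⟩
    rw [motherWavelet_of_half_le, hpe]
    · rw [hle]
      have := h1 v hv
      push_cast at this
      rw [pow_succ]
      linarith
    · rw [hlt, add_comm (1:ℝ)]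
      simpa using h2 v hv
  · refine ⟨0, hzero, fun v hv => ?_⟩
    rw [motherWavelet_of_notMem, Polynomial.eval_zero]
    refine fun h => absurd h.2 (not_lt.mpr ((hle _ _).mpr ?_))
    rw [add_comm (1:ℝ)]
    simpa using h2 v hv

theorem integral_Bkl_mul_Bkl_of_lt
    (horth : ∀ i i' : Fin q, (∫ u in Set.Icc (0:ℝ) 1, B1 q A₁ A₂ u i * B0 q u i') = 0)
    (i' : Fin q) {n₁ n₂ m₁ m₂ : ℕ} (hn : n₁ < n₂) (hm : m₂ < 2 ^ n₂) :
    ∫ u in Icc (0:ℝ) 1,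
      Bkl q A₁ A₂ (n₁ + 1) (m₁ + 1) u i * Bkl q A₁ A₂ (n₂ + 1) (m₂ + 1) u i' = 0 := by
  obtain ⟨d, rfl⟩ := Nat.exists_eq_add_of_lt hn
  obtain ⟨p, hp, hpe⟩ := exists_polynomial_eq_motherWavelet A₁ A₂ i d m₁ m₂
  refine integral_mul_Bkl_eq_zero A₁ A₂ i' horth hm
    (f := fun u => Bkl q A₁ A₂ (n₁ + 1) (m₁ + 1) u i) hp fun v hv => ?_
  rw [Bkl_succ_succ, ← hpe v hv, add_assoc n₁ d 1, pow_add _ n₁ (d + 1)]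
  congr 2
  field_simp

theorem integral_B0_mul_Bkl
    (horth : ∀ i i' : Fin q, (∫ u in Set.Icc (0:ℝ) 1, B1 q A₁ A₂ u i * B0 q u i') = 0)
    (i' : Fin q) {n m : ℕ} (hm : m < 2 ^ n) :
    ∫ u in Icc (0:ℝ) 1, B0 q u i * Bkl q A₁ A₂ (n + 1) (m + 1) u i' = 0 := by
  have hX : ((Polynomial.X : Polynomial ℝ) ^ (i : ℕ)).natDegree < q := by simp
  refine integral_mul_Bkl_eq_zero A₁ A₂ i' horth hm (f := fun u => B0 q u i)
    (natDegree_comp_linear_lt hX (1 / 2 ^ n) (m / 2 ^ n)) fun v _ => ?_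
  simp only [B0, Polynomial.eval_comp, Polynomial.eval_add, Polynomial.eval_mul, Polynomial.eval_C,
    Polynomial.eval_X, Polynomial.eval_pow]
  congr 1
  ring

end

/-- multi-resolution orthogonality. If every component of `B₁` is orthogonal in
`L²([0,1])` to every component of `B₀`, then (i) every block `B_{k,l}` is orthogonal to `B₀`, and
(ii) blocks `B_{k₁,l₁}` and `B_{k₂,l₂}` at different resolution levels `k₁ ≠ k₂` are orthogonal. -/
theorem multiresolution_orthogonality (q : ℕ) (hq : 1 ≤ q)
    (A₁ A₂ : Matrix (Fin q) (Fin q) ℝ)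
    (horth : ∀ i i' : Fin q, (∫ u in Set.Icc (0:ℝ) 1, B1 q A₁ A₂ u i * B0 q u i') = 0) :
    (∀ k : ℕ, 1 ≤ k → ∀ l : ℕ, 1 ≤ l → l ≤ 2 ^ (k - 1) →
      ∀ i i' : Fin q, (∫ u in Set.Icc (0:ℝ) 1, B0 q u i * Bkl q A₁ A₂ k l u i') = 0) ∧
    (∀ k₁ k₂ : ℕ, 1 ≤ k₁ → 1 ≤ k₂ → k₁ ≠ k₂ →
      ∀ l₁ l₂ : ℕ, 1 ≤ l₁ → l₁ ≤ 2 ^ (k₁ - 1) → 1 ≤ l₂ → l₂ ≤ 2 ^ (k₂ - 1) →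
      ∀ i i' : Fin q,
        (∫ u in Set.Icc (0:ℝ) 1, Bkl q A₁ A₂ k₁ l₁ u i * Bkl q A₁ A₂ k₂ l₂ u i') = 0) := by
  constructor
  · intro k hk l hl hlk i i'
    obtain ⟨n, rfl⟩ := Nat.exists_eq_add_of_le' hk
    obtain ⟨m, rfl⟩ := Nat.exists_eq_add_of_le' hl
    exact integral_B0_mul_Bkl A₁ A₂ i horth i' hlk
  · intro k₁ k₂ hk₁ hk₂ hne l₁ l₂ hl₁ hlk₁ hl₂ hlk₂ i i'
    obtain ⟨n₁, rfl⟩ := Nat.exists_eq_add_of_le' hk₁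
    obtain ⟨n₂, rfl⟩ := Nat.exists_eq_add_of_le' hk₂
    obtain ⟨m₁, rfl⟩ := Nat.exists_eq_add_of_le' hl₁
    obtain ⟨m₂, rfl⟩ := Nat.exists_eq_add_of_le' hl₂
    rcases lt_or_gt_of_ne (fun h => hne (congrArg (· + 1) h) : n₁ ≠ n₂) with h | h
    · exact integral_Bkl_mul_Bkl_of_lt A₁ A₂ i horth i' h hlk₂
    · simp only [mul_comm (Bkl q A₁ A₂ (n₁ + 1) (m₁ + 1) _ i)]
      exact integral_Bkl_mul_Bkl_of_lt A₁ A₂ i' horth i h hlk₁
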